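/- Let N ≥ 2 and p ≥ N. Suppose u ≥ 0 is classically p-superharmonic on {x : ‖x‖ > 1} ⊆ EuclideanSpace ℝ (Fin N). Then the function m(r) = inf { u(x) : r < ‖x‖ < 2r } is nondecreasing on (1,∞): for all r, s with 1 < r ≤ s one has m(r) ≤ m(s). -/

import Mathlib

open MeasureTheory Filter Real Matrix
open scoped RealInnerProductSpace

/-- The vector field `F_p u (x) = ‖∇u(x)‖^(p-2) • ∇u(x)` (real power; equal to `0`
when `∇u(x) = 0`). -/
noncomputable def pFlux (N : ℕ) (p : ℝ) (u : EuclideanSpace ℝ (Fin N) → ℝ)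
    (x : EuclideanSpace ℝ (Fin N)) : EuclideanSpace ℝ (Fin N) :=
  ‖gradient u x‖ ^ (p - 2) • gradient u x

/-- The `p`-Laplacian `Δ_p u (x) = div (F_p u) (x)`. -/
noncomputable def pLaplacian (N : ℕ) (p : ℝ) (u : EuclideanSpace ℝ (Fin N) → ℝ)
    (x : EuclideanSpace ℝ (Fin N)) : ℝ :=
  ∑ i : Fin N, ⟪fderiv ℝ (pFlux N p u) x (EuclideanSpace.basisFun (Fin N) ℝ i),
      EuclideanSpace.basisFun (Fin N) ℝ i⟫

/-- `u` is a classical supersolution of `-Δ_p u ≥ g` on `Ω`. -/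
def IsPSupersolution (N : ℕ) (p : ℝ) (u : EuclideanSpace ℝ (Fin N) → ℝ)
    (g : EuclideanSpace ℝ (Fin N) → ℝ) (Ω : Set (EuclideanSpace ℝ (Fin N))) : Prop :=
  ContDiffOn ℝ 1 u Ω ∧ DifferentiableOn ℝ (pFlux N p u) Ω ∧
    ∀ x ∈ Ω, -pLaplacian N p u x ≥ g x

section NormPowers

variable {E : Type*} [NormedAddCommGroup E] [InnerProductSpace ℝ E]

theorem hasFDerivAt_norm_rpow_of_ne_zero {x : E} (hx : x ≠ 0) (a : ℝ) :
    HasFDerivAt (fun y : E => ‖y‖ ^ a) ((a * ‖x‖ ^ (a - 2)) • innerSL ℝ x) x := by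
  have hpos : 0 < ‖x‖ := norm_pos_iff.mpr hx
  have h1 : HasFDerivAt (fun y : E => ‖y‖ ^ 2) (2 • innerSL ℝ x) x :=
    (hasStrictFDerivAt_norm_sq x).hasFDerivAt
  have h2 := h1.rpow_const (p := a / 2) (Or.inl (by positivity))
  have key : ∀ (y : E) (b : ℝ), (‖y‖ ^ 2) ^ b = ‖y‖ ^ (2 * b) := fun y b => by
    rw [Real.rpow_mul (norm_nonneg y), Real.rpow_two]
  simp only [key] at h2
  rw [show 2 * (a / 2) = a by ring, show 2 * (a / 2 - 1) = a - 2 by ring] at h2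
  convert h2 using 1
  ext w
  simp
  ring

theorem hasFDerivAt_norm_rpow_smul {x : E} (hx : x ≠ 0) (a : ℝ) :
    HasFDerivAt (fun y : E => ‖y‖ ^ a • y)
      (‖x‖ ^ a • ContinuousLinearMap.id ℝ E +
        ((a * ‖x‖ ^ (a - 2)) • innerSL ℝ x).smulRight x) x :=
  (hasFDerivAt_norm_rpow_of_ne_zero hx a).smul (hasFDerivAt_id x)

theorem norm_rpow_smul_inverse {p : ℝ} (hp : 1 < p) (q : E) :
    ‖‖q‖ ^ (p - 2) • q‖ ^ (-(p - 2) / (p - 1)) • (‖q‖ ^ (p - 2) • q) = q := by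
  rcases eq_or_ne q 0 with rfl | hq
  · simp
  have hpos : 0 < ‖q‖ := norm_pos_iff.mpr hq
  have h1 : ‖‖q‖ ^ (p - 2) • q‖ = ‖q‖ ^ (p - 1) := by
    rw [norm_smul, Real.norm_of_nonneg (by positivity), show p - 1 = p - 2 + 1 by ring,
      Real.rpow_add_one hpos.ne']
  rw [h1, ← Real.rpow_mul hpos.le, mul_div_cancel₀ _ (by linarith : p - 1 ≠ 0), smul_smul,
    ← Real.rpow_add hpos]
  simp

/-- Necessary second-order condition at a local minimum. -/
theorem IsLocalMin.inner_fderiv_nonneg {f : E → ℝ} {g : E → E} {B : E →L[ℝ] E} {x : E}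
    (hmin : IsLocalMin f x)
    (hf : ∀ᶠ y in nhds x, HasFDerivAt f (innerSL ℝ (g y)) y)
    (hg : HasFDerivAt g B x) (w : E) : 0 ≤ ⟪B w, w⟫ := by
  by_contra! hneg
  set l : ℝ → E := fun t => x + t • w with hl
  have hl0 : l 0 = x := by simp [hl]
  have hld : ∀ t, HasDerivAt l w t := fun t => by
    simpa [hl] using ((hasDerivAt_id t).smul_const w).const_add x
  have hlc : Tendsto l (nhds 0) (nhds x) := by
    simpa [hl0] using (hld 0).continuousAt.tendsto
  have hd : ∀ᶠ t in nhds (0 : ℝ), HasDerivAt (fun t => f (l t)) ⟪g (l t), w⟫ t := by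
    filter_upwards [hlc.eventually hf] with t ht
    exact ht.comp_hasDerivAt t (hld t)
  have hde : deriv (fun t => f (l t)) =ᶠ[nhds 0] fun t => ⟪g (l t), w⟫ :=
    hd.mono fun t ht => ht.deriv
  have hmin' : IsLocalMin (fun t => f (l t)) 0 := by
    have := hlc.eventually hmin
    simpa [IsLocalMin, IsMinFilter, hl0] using this
  have hd2 : HasDerivAt (fun t => ⟪g (l t), w⟫) ⟪B w, w⟫ 0 := by
    have h1 : HasDerivAt (fun t => g (l t)) (B w) 0 := by
      have hg' : HasFDerivAt g B (l 0) := by rwa [hl0]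
      exact hg'.comp_hasDerivAt 0 (hld 0)
    simpa using h1.inner ℝ (hasDerivAt_const (0 : ℝ) w)
  have hdd : deriv (deriv fun t => f (l t)) 0 = ⟪B w, w⟫ := by
    rw [hde.deriv_eq, hd2.deriv]
  have hmax : IsLocalMax (fun t => f (l t)) 0 :=
    isLocalMax_of_deriv_deriv_neg (by rwa [hdd]) hmin'.deriv_eq_zero
      hd.self_of_nhds.continuousAt
  have hconst : (fun t => f (l t)) =ᶠ[nhds 0] fun _ => f (l 0) := by
    filter_upwards [hmin', hmax] with t h1 h2 using le_antisymm h2 h1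
  have hz : deriv (deriv fun t => f (l t)) 0 = 0 := by
    rw [hconst.deriv.deriv_eq]
    simp
  linarith

end NormPowers

section PLaplacian

variable {N : ℕ} {p : ℝ} {u : EuclideanSpace ℝ (Fin N) → ℝ} {x : EuclideanSpace ℝ (Fin N)}

theorem differentiableAt_gradient_of_pFlux (hp : 1 < p)
    (hF : DifferentiableAt ℝ (pFlux N p u) x) (hx : gradient u x ≠ 0) :
    DifferentiableAt ℝ (gradient u) x := by
  have hF0 : pFlux N p u x ≠ 0 :=
    smul_ne_zero (Real.rpow_pos_of_pos (norm_pos_iff.mpr hx) _).ne' hx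
  have h := (hasFDerivAt_norm_rpow_smul hF0 (-(p - 2) / (p - 1))).comp x hF.hasFDerivAt
  refine h.differentiableAt.congr_of_eventuallyEq (Eventually.of_forall fun y => ?_)
  exact (norm_rpow_smul_inverse hp (gradient u y)).symm

theorem pLaplacian_eq {H : EuclideanSpace ℝ (Fin N) →L[ℝ] EuclideanSpace ℝ (Fin N)}
    (hH : HasFDerivAt (gradient u) H x) (hx : gradient u x ≠ 0) :
    pLaplacian N p u x = ‖gradient u x‖ ^ (p - 2) *
        ∑ i, ⟪H (EuclideanSpace.basisFun (Fin N) ℝ i), EuclideanSpace.basisFun (Fin N) ℝ i⟫ +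
      (p - 2) * ‖gradient u x‖ ^ (p - 2 - 2) * ⟪H (gradient u x), gradient u x⟫ := by
  have h : HasFDerivAt (pFlux N p u) _ x :=
    (hasFDerivAt_norm_rpow_smul hx (p - 2)).comp x hH
  set v := gradient u x with hv
  set e := EuclideanSpace.basisFun (Fin N) ℝ with he
  have hs : ⟪H v, v⟫ = ∑ i, ⟪v, H (e i)⟫ * ⟪v, e i⟫ := by
    conv_lhs => rw [← e.sum_repr' v]
    simp only [map_sum, sum_inner, map_smul, real_inner_smul_left]
    refine Finset.sum_congr rfl fun i _ => ?_
    rw [e.sum_repr' v, real_inner_comm v, real_inner_comm v, mul_comm]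
  rw [pLaplacian, h.fderiv, hs, ← he, Finset.mul_sum, Finset.mul_sum, ← Finset.sum_add_distrib]
  clear_value e
  refine Finset.sum_congr rfl fun i _ => ?_
  simp [inner_add_left, real_inner_smul_left]
  ring

theorem not_isLocalMin_sub_norm_rpow (hN : 2 ≤ N) (hpN : (N : ℝ) ≤ p) (hx0 : x ≠ 0)
    (hu : ∀ᶠ y in nhds x, DifferentiableAt ℝ u y)
    (hF : DifferentiableAt ℝ (pFlux N p u) x) (hL : pLaplacian N p u x ≤ 0)
    {c δ : ℝ} (hc : 0 < c) (hδ : 0 < δ) :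
    ¬ IsLocalMin (fun y => u y - c * ‖y‖ ^ (-δ)) x := by
  intro hmin
  have hN' : (2 : ℝ) ≤ N := by exact_mod_cast hN
  have hpos : 0 < ‖x‖ := norm_pos_iff.mpr hx0
  set k : EuclideanSpace ℝ (Fin N) → EuclideanSpace ℝ (Fin N) :=
    fun y => (-(c * δ)) • (‖y‖ ^ (-δ - 2) • y) with hk
  have hgrad : ∀ᶠ y in nhds x, HasFDerivAt (fun y => u y - c * ‖y‖ ^ (-δ))
      (innerSL ℝ (gradient u y - k y)) y := by
    filter_upwards [hu, isOpen_ne.mem_nhds hx0] with y hy hy0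
    have h1 := hy.hasGradientAt.hasFDerivAt
    have h2 := (hasFDerivAt_norm_rpow_of_ne_zero hy0 (-δ)).const_mul c
    refine (h1.sub h2).congr_fderiv (ContinuousLinearMap.ext fun w => ?_)
    simp [hk]
    ring
  have hcrit : gradient u x = k x := by
    have h0 := hmin.hasFDerivAt_eq_zero hgrad.self_of_nhds
    have h1 := DFunLike.congr_fun h0 (gradient u x - k x)
    rw [innerSL_apply_apply, _root_.zero_apply, inner_self_eq_zero] at h1
    exact sub_eq_zero.mp h1
  have hkx : k x = (-(c * δ * ‖x‖ ^ (-δ - 2))) • x := by simp [hk, smul_smul]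
  set κ := c * δ * ‖x‖ ^ (-δ - 2) with hκ
  have hκpos : 0 < κ := by positivity
  have hne : gradient u x ≠ 0 := by
    rw [hcrit, hkx]
    exact smul_ne_zero (neg_ne_zero.mpr hκpos.ne') hx0
  obtain ⟨H, hH⟩ := differentiableAt_gradient_of_pFlux (by linarith) hF hne
  obtain ⟨K, hK, hKw⟩ : ∃ K : EuclideanSpace ℝ (Fin N) →L[ℝ] EuclideanSpace ℝ (Fin N),
      HasFDerivAt k K x ∧
      ∀ w, ⟪K w, w⟫ = -κ * (⟪w, w⟫ - (δ + 2) * ⟪x, w⟫ ^ 2 / ‖x‖ ^ 2) := by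
    refine ⟨_, (hasFDerivAt_norm_rpow_smul hx0 (-δ - 2)).const_smul (-(c * δ)), fun w => ?_⟩
    simp [inner_add_left, real_inner_smul_left]
    rw [Real.rpow_sub hpos (-δ - 2) 2, Real.rpow_two, hκ]
    field_simp
    ring
  have hB := fun w => hmin.inner_fderiv_nonneg hgrad (hH.sub hK) w
  simp only [_root_.sub_apply, inner_sub_left, hKw] at hB
  set e := EuclideanSpace.basisFun (Fin N) ℝ with he
  have hsum : ∑ i, ⟪x, e i⟫ ^ 2 = ‖x‖ ^ 2 := by
    have := e.sum_sq_norm_inner_left x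
    simpa using this
  have htr : -κ * (N - (δ + 2)) ≤ ∑ i, ⟪H (e i), e i⟫ := by
    have h1 : ∑ i, -κ * (⟪e i, e i⟫ - (δ + 2) * ⟪x, e i⟫ ^ 2 / ‖x‖ ^ 2) ≤
        ∑ i, ⟪H (e i), e i⟫ := Finset.sum_le_sum fun i _ => sub_nonneg.mp (hB (e i))
    have h2 : ∀ i, ⟪e i, e i⟫ = 1 := fun i => by
      rw [real_inner_self_eq_norm_sq, e.norm_eq_one]; norm_num
    rw [← Finset.mul_sum, Finset.sum_sub_distrib, ← Finset.sum_div, ← Finset.mul_sum, hsum] at h1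
    simp only [h2] at h1
    rw [mul_div_assoc, div_self (by positivity)] at h1
    simpa using h1
  have hxx : κ * (1 + δ) * ‖x‖ ^ 2 ≤ ⟪H x, x⟫ := by
    have h1 := sub_nonneg.mp (hB x)
    rw [real_inner_self_eq_norm_sq] at h1
    refine le_trans (le_of_eq ?_) h1
    field_simp
    ring
  have hv : ⟪H (gradient u x), gradient u x⟫ = κ ^ 2 * ⟪H x, x⟫ := by
    rw [hcrit, hkx, map_smul, real_inner_smul_left, real_inner_smul_right]
    ring
  have hnv : ‖gradient u x‖ = κ * ‖x‖ := by
    rw [hcrit, hkx, norm_smul, norm_neg, Real.norm_of_nonneg hκpos.le]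
  have hVpos : 0 < ‖gradient u x‖ := norm_pos_iff.mpr hne
  have hexp : pLaplacian N p u x = ‖gradient u x‖ ^ (p - 2) *
      (∑ i, ⟪H (e i), e i⟫ + (p - 2) * (⟪H x, x⟫ / ‖x‖ ^ 2)) := by
    rw [pLaplacian_eq hH hne, ← he, hv, Real.rpow_sub hVpos (p - 2) 2, Real.rpow_two]
    have hr : ‖gradient u x‖ ^ (p - 2) / ‖gradient u x‖ ^ 2 =
        ‖gradient u x‖ ^ (p - 2) / (κ * ‖x‖) ^ 2 := by
      rw [← hnv]
    rw [hr]
    field_simp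
  have hq : κ * (1 + δ) ≤ ⟪H x, x⟫ / ‖x‖ ^ 2 := (le_div_iff₀ (by positivity)).mpr hxx
  have hfin : 0 < ∑ i, ⟪H (e i), e i⟫ + (p - 2) * (⟪H x, x⟫ / ‖x‖ ^ 2) := by
    have h1 := mul_le_mul_of_nonneg_left hq (by linarith : 0 ≤ p - 2)
    have h2 : 0 < κ * ((1 + δ) * (p - 1) - (N - 1)) :=
      mul_pos hκpos (by nlinarith)
    linarith
  have := mul_pos (Real.rpow_pos_of_pos hVpos (p - 2)) hfin
  linarith

/-- A nonnegative `p`-superharmonic function on an exterior domain, with `p ≥ N`, is bounded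
below outside a sphere by any lower bound on the sphere. -/
theorem IsPSupersolution.le_of_le_on_sphere (hN : 2 ≤ N) (hpN : (N : ℝ) ≤ p)
    (hu_nonneg : ∀ x : EuclideanSpace ℝ (Fin N), 1 < ‖x‖ → 0 ≤ u x)
    (hu : IsPSupersolution N p u (fun _ => 0) {x : EuclideanSpace ℝ (Fin N) | 1 < ‖x‖})
    {ρ m : ℝ} (hρ : 1 < ρ) (hm : 0 < m)
    (hsphere : ∀ y : EuclideanSpace ℝ (Fin N), ‖y‖ = ρ → m ≤ u y) (hx : ρ ≤ ‖x‖) :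
    m ≤ u x := by
  obtain ⟨hC, hF, hL⟩ := hu
  have hΩ : IsOpen {x : EuclideanSpace ℝ (Fin N) | 1 < ‖x‖} :=
    isOpen_lt continuous_const continuous_norm
  have hρ0 : 0 < ρ := by linarith
  have hbarrier : ∀ δ : ℝ, 0 < δ → m * (‖x‖ / ρ) ^ (-δ) ≤ u x := by
    intro δ hδ
    set c := m * ρ ^ δ with hc
    have hcpos : 0 < c := by positivity
    have hcρ : c * ρ ^ (-δ) = m := by
      rw [hc, mul_assoc, ← Real.rpow_add hρ0]; simp
    have hcx : m * (‖x‖ / ρ) ^ (-δ) = c * ‖x‖ ^ (-δ) := by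
      rw [Real.div_rpow (norm_nonneg x) hρ0.le, ← hcρ]
      field_simp
    rw [hcx]
    refine le_of_forall_pos_le_add fun ε hε => ?_
    obtain ⟨R, hRx, hRε⟩ : ∃ R, ‖x‖ ≤ R ∧ c * R ^ (-δ) < ε := by
      have ht : Tendsto (fun R : ℝ => c * R ^ (-δ)) atTop (nhds 0) := by
        simpa using (tendsto_rpow_neg_atTop hδ).const_mul c
      exact ((eventually_ge_atTop ‖x‖).and (ht.eventually_lt_const hε)).exists
    set A : Set (EuclideanSpace ℝ (Fin N)) := {y | ρ ≤ ‖y‖ ∧ ‖y‖ ≤ R} with hA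
    have hAc : IsCompact A := by
      refine (isCompact_closedBall (0 : EuclideanSpace ℝ (Fin N)) R).of_isClosed_subset
        ((isClosed_le continuous_const continuous_norm).inter
          (isClosed_le continuous_norm continuous_const)) fun y hy => ?_
      simpa using hy.2
    have hcont : ContinuousOn (fun y => u y - c * ‖y‖ ^ (-δ)) A := by
      refine (hC.continuousOn.mono fun y hy => lt_of_lt_of_le hρ hy.1).sub
        (continuousOn_const.mul (continuous_norm.continuousOn.rpow_const fun y hy => ?_))
      exact Or.inl (hρ0.trans_le hy.1).ne'
    obtain ⟨z, hzA, hz⟩ := hAc.exists_isMinOn ⟨x, hx, hRx⟩ hcont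
    have hzx : u z - c * ‖z‖ ^ (-δ) ≤ u x - c * ‖x‖ ^ (-δ) := hz ⟨hx, hRx⟩
    have hz1 : 1 < ‖z‖ := hρ.trans_le hzA.1
    rcases hzA.1.eq_or_lt with h1 | h1
    · have := hsphere z h1.symm
      rw [← h1, hcρ] at hzx
      linarith
    rcases hzA.2.eq_or_lt with h2 | h2
    · have := hu_nonneg z hz1
      rw [h2] at hzx
      linarith
    have hAz : A ∈ nhds z := by
      filter_upwards [(isOpen_lt continuous_const continuous_norm).mem_nhds h1,
        (isOpen_lt continuous_norm continuous_const).mem_nhds h2] with y hy1 hy2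
      exact ⟨le_of_lt hy1, le_of_lt hy2⟩
    refine absurd (hz.isLocalMin hAz) (not_isLocalMin_sub_norm_rpow hN hpN
      (norm_pos_iff.mp (by linarith)) ?_ (hF.differentiableAt (hΩ.mem_nhds hz1))
      (by have := hL z hz1; simp only at this; linarith) hcpos hδ)
    filter_upwards [hΩ.mem_nhds hz1] with y hy
    exact (hC.differentiableOn one_ne_zero).differentiableAt (hΩ.mem_nhds hy)
  have hq : 0 < ‖x‖ / ρ := div_pos (hρ0.trans_le hx) hρ0
  have hlim : Tendsto (fun δ : ℝ => m * (‖x‖ / ρ) ^ (-δ)) (nhdsWithin 0 (Set.Ioi 0))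
      (nhds m) := by
    have hc : Continuous fun δ : ℝ => m * (‖x‖ / ρ) ^ (-δ) :=
      continuous_const.mul (Real.continuous_const_rpow hq.ne' |>.comp continuous_neg)
    have := (hc.tendsto 0).mono_left (nhdsWithin_le_nhds (s := Set.Ioi 0))
    simpa using this
  exact le_of_tendsto hlim (eventually_mem_nhdsWithin.mono fun δ hδ => hbarrier δ hδ)

end PLaplacian

/-- If `N ≥ 2`, `p ≥ N`, and `u ≥ 0` is classically `p`-superharmonic on `{‖x‖ > 1}`, then
`m(r) = inf_{r < ‖x‖ < 2r} u(x)` is nondecreasing on `(1,∞)`. -/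
theorem m_monotone_p_ge_N (N : ℕ) (hN : 2 ≤ N) (p : ℝ) (hpN : (N : ℝ) ≤ p)
    (u : EuclideanSpace ℝ (Fin N) → ℝ)
    (hu_nonneg : ∀ x : EuclideanSpace ℝ (Fin N), 1 < ‖x‖ → 0 ≤ u x)
    (hu_super : IsPSupersolution N p u (fun _ => 0)
      {x : EuclideanSpace ℝ (Fin N) | 1 < ‖x‖}) :
    ∀ r s : ℝ, 1 < r → r ≤ s →
      sInf (u '' {x : EuclideanSpace ℝ (Fin N) | r < ‖x‖ ∧ ‖x‖ < 2 * r}) ≤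
      sInf (u '' {x : EuclideanSpace ℝ (Fin N) | s < ‖x‖ ∧ ‖x‖ < 2 * s}) := by
  intro r s hr hrs
  set m := sInf (u '' {x : EuclideanSpace ℝ (Fin N) | r < ‖x‖ ∧ ‖x‖ < 2 * r}) with hm
  have hlow : ∀ y : EuclideanSpace ℝ (Fin N), r < ‖y‖ → ‖y‖ < 2 * r → m ≤ u y := by
    intro y hy1 hy2
    refine csInf_le ⟨0, ?_⟩ ⟨y, ⟨hy1, hy2⟩, rfl⟩
    rintro _ ⟨z, hz, rfl⟩
    exact hu_nonneg z (hr.trans hz.1)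
  rcases le_or_gt m 0 with hm0 | hm0
  · refine hm0.trans (Real.sInf_nonneg ?_)
    rintro _ ⟨z, hz, rfl⟩
    exact hu_nonneg z (by linarith [hz.1])
  have hne : {x : EuclideanSpace ℝ (Fin N) | s < ‖x‖ ∧ ‖x‖ < 2 * s}.Nonempty := by
    refine ⟨EuclideanSpace.single ⟨0, by omega⟩ (3 / 2 * s), ?_⟩
    rw [Set.mem_ofPred_eq, PiLp.norm_single, Real.norm_of_nonneg (by linarith)]
    constructor <;> linarith
  refine le_csInf (hne.image u) ?_
  rintro _ ⟨x, ⟨hx1, -⟩, rfl⟩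
  rcases lt_or_ge ‖x‖ (2 * r) with h | h
  · exact hlow x (by linarith) h
  · exact hu_super.le_of_le_on_sphere hN hpN hu_nonneg (ρ := 3 / 2 * r) (by linarith) hm0
      (fun y hy => hlow y (by linarith) (by linarith)) (by linarith)
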